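/- Let Γ be an extended propositional A⁺-A⁻-theory and (Y,Y) a total HT-interpretation. If (Y,Y) ⊨ Γ, then (X',Y) ⊨ Γ for all X' ⊆ Y such that X' ∩ A⁺ = Y ∩ A⁺. -/

import Mathlib

/-- Propositional formulas over atoms of type `α`. -/
inductive PForm (α : Type) : Type where
  | atom : α → PForm α
  | bot  : PForm α
  | conj : PForm α → PForm α → PForm α
  | disj : PForm α → PForm α → PForm α
  | impl : PForm α → PForm α → PForm α

namespace PForm

variable {α : Type}

/-- Classical satisfaction by a set of atoms. -/
def clSat (Y : Set α) : PForm α → Prop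
  | atom a   => a ∈ Y
  | bot      => False
  | conj φ ψ => clSat Y φ ∧ clSat Y ψ
  | disj φ ψ => clSat Y φ ∨ clSat Y ψ
  | impl φ ψ => clSat Y φ → clSat Y ψ

/-- HT-satisfaction by a pair (X,Y) of sets of atoms. -/
def htSat (X Y : Set α) : PForm α → Prop
  | atom a   => a ∈ X
  | bot      => False
  | conj φ ψ => htSat X Y φ ∧ htSat X Y ψ
  | disj φ ψ => htSat X Y φ ∨ htSat X Y ψ
  | impl φ ψ => (htSat X Y φ → htSat X Y ψ) ∧ (clSat Y φ → clSat Y ψ)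

/-- Factual formulas: built from ∧, ∨, ⊥ and negations φ → ⊥ only. -/
def Factual : PForm α → Prop
  | atom _   => True
  | bot      => True
  | conj φ ψ => Factual φ ∧ Factual ψ
  | disj φ ψ => Factual φ ∧ Factual ψ
  | impl φ ψ => Factual φ ∧ ψ = PForm.bot

/-- All atoms of the formula belong to `L`. -/
def atomsIn (L : Set α) : PForm α → Prop
  | atom a   => a ∈ L
  | bot      => True
  | conj φ ψ => atomsIn L φ ∧ atomsIn L ψ
  | disj φ ψ => atomsIn L φ ∧ atomsIn L ψ
  | impl φ ψ => atomsIn L φ ∧ atomsIn L ψ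

end PForm

abbrev Theory (α : Type) := Set (PForm α)

variable {α : Type}

/-- An HT-interpretation (X,Y) satisfies a theory. -/
def htSatT (X Y : Set α) (Γ : Theory α) : Prop := ∀ φ ∈ Γ, PForm.htSat X Y φ

/-- Classical satisfaction of a theory. -/
def clSatT (Y : Set α) (Γ : Theory α) : Prop := ∀ φ ∈ Γ, PForm.clSat Y φ

/-- A factual theory. -/
def FactualT (Γ : Theory α) : Prop := ∀ φ ∈ Γ, PForm.Factual φ

/-- Y is an answer set of Γ, i.e. (Y,Y) is an equilibrium model of Γ. -/
def IsAnswerSet (Γ : Theory α) (Y : Set α) : Prop :=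
  htSatT Y Y Γ ∧ ∀ X, X ⊂ Y → ¬ htSatT X Y Γ

/-- Answer-set equivalence. -/
def AnswerEquiv (Γ₁ Γ₂ : Theory α) : Prop :=
  ∀ Y : Set α, IsAnswerSet Γ₁ Y ↔ IsAnswerSet Γ₂ Y

/-- Classical equivalence. -/
def ClassEquiv (Γ₁ Γ₂ : Theory α) : Prop :=
  ∀ Y : Set α, clSatT Y Γ₁ ↔ clSatT Y Γ₂

/-- Strong equivalence. -/
def StrongEquiv (Γ₁ Γ₂ : Theory α) : Prop :=
  ∀ Γ : Theory α, AnswerEquiv (Γ₁ ∪ Γ) (Γ₂ ∪ Γ)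

/-- Uniform equivalence (wrt factual theories). -/
def UnifEquiv (Γ₁ Γ₂ : Theory α) : Prop :=
  ∀ Γ : Theory α, FactualT Γ → AnswerEquiv (Γ₁ ∪ Γ) (Γ₂ ∪ Γ)

/-- The set of HT-countermodels of Γ. -/
def Cs (Γ : Theory α) : Set (Set α × Set α) :=
  {p | p.1 ⊆ p.2 ∧ ¬ htSatT p.1 p.2 Γ}

/-- The set of equivalence interpretations of Γ: total HT-models and here-countermodels. -/
def Es (Γ : Theory α) : Set (Set α × Set α) :=
  {p | p.1 ⊆ p.2 ∧
    ((p.1 = p.2 ∧ htSatT p.1 p.2 Γ) ∨ (¬ htSatT p.1 p.2 Γ ∧ clSatT p.2 Γ))}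

/-- (X,Y) is there-closed in a set S of HT-interpretations. -/
def ThereClosedIn (S : Set (Set α × Set α)) (X Y : Set α) : Prop :=
  (Y, Y) ∉ S ∧ ∀ X', X ⊆ X' → X' ⊂ Y → (X', Y) ∈ S

/-- (X,Y) is closed in a set S of HT-interpretations. -/
def ClosedIn (S : Set (Set α × Set α)) (X Y : Set α) : Prop :=
  ∀ X', X ⊆ X' → X' ⊆ Y → (X', Y) ∈ S

/-- C_u(Γ): there-closed HT-interpretations wrt the countermodels of Γ. -/
def Cu (Γ : Theory α) : Set (Set α × Set α) :=
  {p | p.1 ⊆ p.2 ∧ ThereClosedIn (Cs Γ) p.1 p.2}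


/-- Polarity-correct occurrence of atoms: `APol Ap An true φ` states that the formula φ,
itself occurring positively, has all its positively occurring atoms in `Ap` and all its
negatively occurring atoms in `An` (atoms in antecedents of implications occur negatively,
atoms in consequents occur positively; in a negatively occurring implication — e.g. the
antecedent φ₁ of (φ₁→φ₂)→φ₃ — both components additionally occur with both polarities). -/
def APol (Ap An : Set α) : Bool → PForm α → Prop
  | p, .atom a => if p then a ∈ Ap else a ∈ An
  | _, .bot => True
  | p, .conj φ ψ => APol Ap An p φ ∧ APol Ap An p ψ
  | p, .disj φ ψ => APol Ap An p φ ∧ APol Ap An p ψ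
  | true, .impl φ ψ => APol Ap An false φ ∧ APol Ap An true ψ
  | false, .impl φ ψ =>
      (APol Ap An false φ ∧ APol Ap An true φ) ∧ (APol Ap An true ψ ∧ APol Ap An false ψ)

/-- An A⁺-A⁻-theory. -/
def IsAATheory (Ap An : Set α) (Γ : Theory α) : Prop :=
  ∀ φ ∈ Γ, APol Ap An true φ

/-- An extended A⁺-A⁻-theory: additionally factual formulas over A⁺ are permitted. -/
def IsExtAATheory (Ap An : Set α) (Γ : Theory α) : Prop :=
  ∀ φ ∈ Γ, APol Ap An true φ ∨ (PForm.Factual φ ∧ PForm.atomsIn Ap φ)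

/-- Relativized hyperequivalence wrt A⁺ and A⁻. -/
def HyperEquiv (Ap An : Set α) (Γ₁ Γ₂ : Theory α) : Prop :=
  ∀ Γ : Theory α, IsAATheory Ap An Γ → AnswerEquiv (Γ₁ ∪ Γ) (Γ₂ ∪ Γ)

/-- (Y,Y) is A⁺-total: (Y ∩ A⁺, Y) is closed in E_s(Γ). -/
def ApTotal (Ap : Set α) (Γ : Theory α) (Y : Set α) : Prop :=
  ∀ X', Y ∩ Ap ⊆ X' → X' ⊆ Y → (X', Y) ∈ Es Γ

/-- (X,Y) is A⁺-closed in E_s(Γ). -/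
def ApClosed (Ap An : Set α) (Γ : Theory α) (X Y : Set α) : Prop :=
  ∀ X', X' ⊆ Y → X ∩ Ap ⊆ X' ∩ Ap → X' ∩ An ⊆ X ∩ An → (X', Y) ∈ Es Γ

/-- E^{A⁺}_{A⁻}(Γ): the HT-hyperequivalence interpretations of Γ wrt A⁺ and A⁻. -/
def Eh (Ap An : Set α) (Γ : Theory α) : Set (Set α × Set α) :=
  {p | p.1 ⊆ p.2 ∧ ApTotal Ap Γ p.2 ∧
    ∃ X', X' ⊆ p.2 ∧ p.1 = X' ∩ (Ap ∪ An) ∧ ApClosed Ap An Γ X' p.2}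

theorem aux_persist {X Y : Set α} (h : X ⊆ Y) (φ : PForm α) :
    PForm.htSat X Y φ → PForm.clSat Y φ := by
  induction φ with
  | atom a => exact fun ha => h ha
  | bot => exact id
  | conj φ ψ h1 h2 => exact fun hh => ⟨h1 hh.1, h2 hh.2⟩
  | disj φ ψ h1 h2 => exact fun hh => hh.imp h1 h2
  | impl φ ψ h1 h2 => exact fun hh => hh.2

theorem aux_pol {X Y Ap An : Set α} (h : X ⊆ Y) (hp : X ∩ Ap = Y ∩ Ap) (φ : PForm α) :
    (APol Ap An true φ ∨ PForm.atomsIn Ap φ) → PForm.clSat Y φ → PForm.htSat X Y φ := by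
  induction φ with
  | atom a =>
    intro ha hy
    have ha' : a ∈ Ap := by simpa [APol, PForm.atomsIn] using ha
    have : a ∈ X ∩ Ap := hp ▸ ⟨hy, ha'⟩
    exact this.1
  | bot => exact fun _ => id
  | conj φ ψ h1 h2 =>
    intro ha hh
    simp only [APol, PForm.atomsIn] at ha
    exact ⟨h1 (ha.imp And.left And.left) hh.1, h2 (ha.imp And.right And.right) hh.2⟩
  | disj φ ψ h1 h2 =>
    intro ha hh
    simp only [APol, PForm.atomsIn] at ha
    exact Or.imp (h1 (ha.imp And.left And.left)) (h2 (ha.imp And.right And.right)) hh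
  | impl φ ψ h1 h2 =>
    intro ha hh
    simp only [APol, PForm.atomsIn] at ha
    exact ⟨fun hφ => h2 (ha.imp And.right And.right) (hh (aux_persist h φ hφ)), hh⟩

/-- For an extended A⁺-A⁻-theory Γ, if (Y,Y) ⊨ Γ then (X',Y) ⊨ Γ for all
X' ⊆ Y with X' ∩ A⁺ = Y ∩ A⁺. -/
theorem ext_AA_theory_total_monotone (Ap An : Set α) (Γ : Theory α)
    (hΓ : IsExtAATheory Ap An Γ) (Y : Set α) (hsat : htSatT Y Y Γ)
    (X' : Set α) (hX'Y : X' ⊆ Y) (hp : X' ∩ Ap = Y ∩ Ap) :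
    htSatT X' Y Γ := by
  intro φ hφ
  exact aux_pol hX'Y hp φ ((hΓ φ hφ).imp id And.right)
    (aux_persist (subset_refl Y) φ (hsat φ hφ))
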